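/- (Remark 1) Under the stepsize condition α ≤ min{(1 + λ_n(W))/L_h, 1/L_f̄} and β < 1, every local objective error is controlled by the mean objective error: for every agent i and all k ≥ 0, f̄(x_{(i)}(k)) − f̄* ≤ r̄(k) + α D²/(1 − β), where D := √(2 L_h (Σ_{i=1}^n f_i(0) − Σ_{i=1}^n inf_x f_i(x))). -/

import Mathlib

open scoped RealInnerProductSpace

section helpers

variable {E : Type*} [NormedAddCommGroup E] [InnerProductSpace ℝ E] [CompleteSpace E]

lemma aux_line_deriv {f : E → ℝ} {g : E → E} (hg : ∀ z, HasGradientAt f (g z) z) (z d : E) (t : ℝ) :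
    HasDerivAt (fun s : ℝ => f (z + s • d)) ⟪g (z + t • d), d⟫ t := by
  have h1 : HasDerivAt (fun s : ℝ => z + s • d) d t := by
    simpa using ((hasDerivAt_id t).smul_const d).const_add z
  have h2 := (hg (z + t • d)).hasFDerivAt.comp_hasDerivAt t h1
  simpa [Function.comp_def] using h2

lemma aux_convex {f : E → ℝ} {g : E → E} (hg : ∀ z, HasGradientAt f (g z) z)
    (hc : ConvexOn ℝ Set.univ f) (z y : E) : f z + ⟪g z, y - z⟫ ≤ f y := by
  have hφ : ConvexOn ℝ Set.univ (fun s : ℝ => f (z + s • (y - z))) := by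
    refine ⟨convex_univ, ?_⟩
    intro s _ t _ a b ha hb hab
    have := hc.2 (Set.mem_univ (z + s • (y - z))) (Set.mem_univ (z + t • (y - z))) ha hb hab
    refine le_trans (le_of_eq ?_) this
    show f _ = f _
    congr 1
    obtain rfl : b = 1 - a := by linarith
    simp only [smul_eq_mul]
    module
  have h := hφ.le_slope_of_hasDerivAt (Set.mem_univ 0) (Set.mem_univ 1) one_pos
    (aux_line_deriv hg z (y - z) 0)
  simp [slope_def_field] at h
  linarith

lemma aux_descent {f : E → ℝ} {g : E → E} (hg : ∀ z, HasGradientAt f (g z) z) {L : ℝ}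
    (hL : ∀ a b, ‖g a - g b‖ ≤ L * ‖a - b‖) (z y : E) :
    f y ≤ f z + ⟪g z, y - z⟫ + L / 2 * ‖y - z‖ ^ 2 := by
  set d := y - z with hd
  have hder : ∀ t : ℝ, HasDerivAt (fun s : ℝ => f (z + s • d) - s * ⟪g z, d⟫ - L / 2 * ‖d‖ ^ 2 * s ^ 2)
      (⟪g (z + t • d), d⟫ - ⟪g z, d⟫ - L / 2 * ‖d‖ ^ 2 * (2 * t)) t := by
    intro t
    have h1 := aux_line_deriv hg z d t
    have h2 : HasDerivAt (fun s : ℝ => s * ⟪g z, d⟫) ⟪g z, d⟫ t := by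
      simpa using (hasDerivAt_id t).mul_const ⟪g z, d⟫
    have h3 : HasDerivAt (fun s : ℝ => L / 2 * ‖d‖ ^ 2 * s ^ 2) (L / 2 * ‖d‖ ^ 2 * (2 * t)) t := by
      simpa using (hasDerivAt_pow 2 t).const_mul (L / 2 * ‖d‖ ^ 2)
    exact (h1.sub h2).sub h3
  have hanti := antitoneOn_of_deriv_nonpos (convex_Icc (0:ℝ) 1)
    (fun t _ => (hder t).continuousAt.continuousWithinAt)
    (fun t _ => (hder t).differentiableAt.differentiableWithinAt)
    (by
      intro t ht
      rw [interior_Icc] at ht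
      rw [(hder t).deriv, ← inner_sub_left]
      have h1 := real_inner_le_norm (g (z + t • d) - g z) d
      have h2 := hL (z + t • d) z
      rw [add_sub_cancel_left, norm_smul, Real.norm_eq_abs, abs_of_pos ht.1] at h2
      nlinarith [norm_nonneg d])
  have h := hanti (Set.left_mem_Icc.2 zero_le_one) (Set.right_mem_Icc.2 zero_le_one) zero_le_one
  simp [hd] at h
  simp only [hd]
  linarith

lemma aux_grad_bound {f : E → ℝ} {g : E → E} (hg : ∀ z, HasGradientAt f (g z) z) {L : ℝ}
    (hLpos : 0 < L) (hL : ∀ a b, ‖g a - g b‖ ≤ L * ‖a - b‖) (hb : BddBelow (Set.range f)) (z : E) :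
    ‖g z‖ ^ 2 ≤ 2 * L * (f z - ⨅ y, f y) := by
  have h1 := aux_descent hg hL z (z - L⁻¹ • g z)
  have h2 : (⨅ y, f y) ≤ f (z - L⁻¹ • g z) := ciInf_le hb _
  have h3 : z - L⁻¹ • g z - z = -(L⁻¹ • g z) := by abel
  rw [h3, inner_neg_right, real_inner_smul_right, real_inner_self_eq_norm_sq, norm_neg, norm_smul,
    Real.norm_eq_abs, abs_of_pos (inv_pos.2 hLpos)] at h1
  have h4 : -(L⁻¹ * ‖g z‖ ^ 2) + L / 2 * (L⁻¹ * ‖g z‖) ^ 2 = - (‖g z‖ ^ 2 / (2 * L)) := by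
    field_simp; ring
  have h5 : ‖g z‖ ^ 2 / (2 * L) ≤ f z - ⨅ y, f y := by linarith
  rw [div_le_iff₀ (by positivity)] at h5
  linarith

end helpers

lemma aux_spec {n : ℕ} (W : Matrix (Fin n) (Fin n) ℝ) (hW : W.IsHermitian)
    (u : Fin n → ℝ) : ∃ c : Fin n → ℝ,
    (∀ k, c k = ∑ i, hW.eigenvectorBasis k i * u i) ∧
    ∑ i, u i ^ 2 = ∑ k, c k ^ 2 ∧
    ∑ i, u i * ∑ j, W i j * u j = ∑ k, hW.eigenvalues k * c k ^ 2 ∧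
    ∑ i, (∑ j, W i j * u j) ^ 2 = ∑ k, hW.eigenvalues k ^ 2 * c k ^ 2 := by
  set b := hW.eigenvectorBasis
  have hin : ∀ (w : Fin n → ℝ) k, ⟪b k, WithLp.toLp 2 w⟫ = ∑ i, b k i * w i := by
    intro w k
    simp [PiLp.inner_apply, mul_comm]
  have heig : ∀ k, ∑ i, b k i * (∑ j, W i j * u j) = hW.eigenvalues k * ∑ i, b k i * u i := by
    intro k
    have h := hW.mulVec_eigenvectorBasis k
    have h' : ∀ j, ∑ i, W i j * b k i = hW.eigenvalues k * b k j := by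
      intro j
      have := congrFun h j
      simp only [Matrix.mulVec, dotProduct, Pi.smul_apply, smul_eq_mul] at this
      rw [← this]
      refine Finset.sum_congr rfl fun i _ => ?_
      rw [← hW.apply i j]; simp [b]
    simp_rw [Finset.mul_sum]
    rw [Finset.sum_comm]
    refine Finset.sum_congr rfl fun j _ => ?_
    rw [← mul_assoc, ← h' j, Finset.sum_mul]
    exact Finset.sum_congr rfl fun i _ => by ring
  have hpars : ∀ w w' : Fin n → ℝ, ∑ i, w i * w' i
      = ∑ k, (∑ i, b k i * w i) * (∑ i, b k i * w' i) := by
    intro w w'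
    have := b.sum_inner_mul_inner (WithLp.toLp 2 w) (WithLp.toLp 2 w')
    simp_rw [real_inner_comm (b _) (WithLp.toLp 2 w), hin] at this
    rw [this]
    simp [PiLp.inner_apply, mul_comm]
  refine ⟨fun k => ∑ i, b k i * u i, fun k => rfl, ?_, ?_, ?_⟩
  · simpa [sq] using hpars u u
  · rw [hpars]
    exact Finset.sum_congr rfl fun k _ => by rw [heig]; ring
  · simp_rw [sq (∑ j, W _ j * u j)]
    rw [hpars]
    exact Finset.sum_congr rfl fun k _ => by rw [heig]; ring

lemma aux_top {n : ℕ} (hn : 0 < n) (W : Matrix (Fin n) (Fin n) ℝ) (hW : W.IsHermitian)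
    (hWrow : ∀ i, ∑ j, W i j = 1) (k0 : Fin n) (β : ℝ) (hβ : β < 1)
    (hk : ∀ k, k ≠ k0 → |hW.eigenvalues k| ≤ β) (u : Fin n → ℝ) (hu : ∑ i, u i = 0) :
    ∑ i, hW.eigenvectorBasis k0 i * u i = 0 := by
  set b := hW.eigenvectorBasis with hb
  have hcol : ∀ j, ∑ i, W i j = 1 := fun j => by
    rw [← hWrow j]; exact Finset.sum_congr rfl fun i _ => by rw [← hW.apply i j]; simp
  have hz : ∀ k, k ≠ k0 → ∑ i, b k i = 0 := by
    intro k hkk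
    have h := hW.mulVec_eigenvectorBasis k
    have h2 : ∑ j, (∑ i, W j i * b k i) = hW.eigenvalues k * ∑ j, b k j := by
      rw [Finset.mul_sum]
      refine Finset.sum_congr rfl fun j _ => ?_
      have := congrFun h j
      simpa only [Matrix.mulVec, dotProduct, Pi.smul_apply, smul_eq_mul] using this
    rw [Finset.sum_comm] at h2
    simp_rw [← Finset.sum_mul, hcol, one_mul] at h2
    have h3 := (abs_le.1 (hk k hkk)).2
    have h4 : (1 - hW.eigenvalues k) * ∑ j, b k j = 0 := by linarith
    rcases mul_eq_zero.1 h4 with h | h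
    · linarith
    · exact h
  have hpars : ∀ w : Fin n → ℝ, ∑ i, w i
      = (∑ i, b k0 i) * (∑ i, b k0 i * w i) := by
    intro w
    have := b.sum_inner_mul_inner (WithLp.toLp 2 (fun _ => (1:ℝ))) (WithLp.toLp 2 w)
    rw [Finset.sum_eq_single k0] at this
    · simpa [PiLp.inner_apply, mul_comm] using this.symm
    · intro k _ hkk
      have := hz k hkk
      simp [PiLp.inner_apply, this]
    · simp
  have h1 := hpars (fun _ => 1)
  have h2 := hpars u
  rw [hu] at h2
  rcases mul_eq_zero.1 h2.symm with h | h
  · rw [h] at h1; simp at h1; omega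
  · exact h

lemma aux_vec {n p : ℕ} (W : Matrix (Fin n) (Fin n) ℝ) (v : Fin n → EuclideanSpace ℝ (Fin p)) :
    ∑ i, ‖v i‖ ^ 2 = ∑ a, ∑ i, (v i a) ^ 2 ∧
    ∑ i, ⟪v i, ∑ j, W i j • v j⟫ = ∑ a, ∑ i, v i a * ∑ j, W i j * v j a ∧
    ∑ i, ‖∑ j, W i j • v j‖ ^ 2 = ∑ a, ∑ i, (∑ j, W i j * v j a) ^ 2 := by
  refine ⟨?_, ?_, ?_⟩
  · rw [Finset.sum_comm]; simp [EuclideanSpace.norm_sq_eq]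
  · rw [Finset.sum_comm]; simp [PiLp.inner_apply, mul_comm]
  · rw [Finset.sum_comm]; simp [EuclideanSpace.norm_sq_eq]

lemma aux_lower {n p : ℕ} (W : Matrix (Fin n) (Fin n) ℝ) (hW : W.IsHermitian)
    (l : ℝ) (hl : ∀ k, l ≤ hW.eigenvalues k) (v : Fin n → EuclideanSpace ℝ (Fin p)) :
    l * ∑ i, ‖v i‖ ^ 2 ≤ ∑ i, ⟪v i, ∑ j, W i j • v j⟫ := by
  obtain ⟨h1, h2, -⟩ := aux_vec W v
  rw [h1, h2, Finset.mul_sum]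
  refine Finset.sum_le_sum fun a _ => ?_
  obtain ⟨c, -, e1, e2, -⟩ := aux_spec W hW (fun i => v i a)
  rw [e1, e2, Finset.mul_sum]
  exact Finset.sum_le_sum fun k _ => mul_le_mul_of_nonneg_right (hl k) (sq_nonneg _)

lemma aux_upper {n p : ℕ} (hn : 0 < n) (W : Matrix (Fin n) (Fin n) ℝ) (hW : W.IsHermitian)
    (hWrow : ∀ i, ∑ j, W i j = 1) (k0 : Fin n) (β : ℝ) (hβ : β < 1)
    (hk : ∀ k, k ≠ k0 → |hW.eigenvalues k| ≤ β)
    (v : Fin n → EuclideanSpace ℝ (Fin p)) (hv : ∑ i, v i = 0) :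
    ∑ i, ⟪v i, ∑ j, W i j • v j⟫ ≤ β * ∑ i, ‖v i‖ ^ 2 ∧
    ∑ i, ‖∑ j, W i j • v j‖ ^ 2 ≤ β ^ 2 * ∑ i, ‖v i‖ ^ 2 := by
  obtain ⟨h1, h2, h3⟩ := aux_vec W v
  have hva : ∀ a, ∑ i, v i a = 0 := fun a => by
    have := congrArg (fun w : EuclideanSpace ℝ (Fin p) => w a) hv
    simpa using this
  rw [h1, h2, h3, Finset.mul_sum, Finset.mul_sum]
  constructor <;> refine Finset.sum_le_sum fun a _ => ?_ <;>
  obtain ⟨c, hc, e1, e2, e3⟩ := aux_spec W hW (fun i => v i a) <;>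
  have hc0 : c k0 = 0 := by
    rw [hc]; exact aux_top hn W hW hWrow k0 β hβ hk _ (hva a)
  · rw [e1, e2, Finset.mul_sum]
    refine Finset.sum_le_sum fun k _ => ?_
    by_cases hkk : k = k0
    · simp [hkk, hc0]
    · exact mul_le_mul_of_nonneg_right (abs_le.1 (hk k hkk)).2 (sq_nonneg _)
  · rw [e1, e3, Finset.mul_sum]
    refine Finset.sum_le_sum fun k _ => ?_
    by_cases hkk : k = k0
    · simp [hkk, hc0]
    · refine mul_le_mul_of_nonneg_right ?_ (sq_nonneg _)
      rw [← sq_abs (hW.eigenvalues k)]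
      exact pow_le_pow_left₀ (abs_nonneg _) (hk k hkk) 2

section helpers2

variable {n : ℕ} {E : Type*} [NormedAddCommGroup E] [InnerProductSpace ℝ E]

lemma aux_symm (W : Matrix (Fin n) (Fin n) ℝ) (hW : W.IsHermitian) (u v : Fin n → E) :
    ∑ i, ⟪u i, ∑ j, W i j • v j⟫ = ∑ i, ⟪v i, ∑ j, W i j • u j⟫ := by
  simp_rw [inner_sum, real_inner_smul_right]
  rw [Finset.sum_comm]
  refine Finset.sum_congr rfl fun i _ => Finset.sum_congr rfl fun j _ => ?_
  rw [real_inner_comm, ← hW.apply i j]; simp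

lemma aux_Q_add (W : Matrix (Fin n) (Fin n) ℝ) (hW : W.IsHermitian) (u d : Fin n → E) :
    (∑ i, ‖u i + d i‖ ^ 2) - ∑ i, ⟪u i + d i, ∑ j, W i j • (u j + d j)⟫
    = ((∑ i, ‖u i‖ ^ 2) - ∑ i, ⟪u i, ∑ j, W i j • u j⟫)
      + 2 * ∑ i, ⟪u i - ∑ j, W i j • u j, d i⟫
      + ((∑ i, ‖d i‖ ^ 2) - ∑ i, ⟪d i, ∑ j, W i j • d j⟫) := by
  have h := aux_symm W hW u d
  have h2 : ∑ i, ⟪∑ j, W i j • u j, d i⟫ = ∑ i, ⟪d i, ∑ j, W i j • u j⟫ :=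
    Finset.sum_congr rfl fun i _ => real_inner_comm _ _
  simp_rw [smul_add, Finset.sum_add_distrib, norm_add_sq_real, inner_add_left, inner_add_right,
    inner_sub_left, Finset.sum_add_distrib, Finset.sum_sub_distrib, ← Finset.mul_sum]
  rw [h2, h]
  ring

lemma aux_Q_shift (W : Matrix (Fin n) (Fin n) ℝ) (hW : W.IsHermitian)
    (hWrow : ∀ i, ∑ j, W i j = 1) (u : Fin n → E) (c : E) :
    (∑ i, ‖u i - c‖ ^ 2) - ∑ i, ⟪u i - c, ∑ j, W i j • (u j - c)⟫
    = ((∑ i, ‖u i‖ ^ 2) - ∑ i, ⟪u i, ∑ j, W i j • u j⟫) := by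
  have h := aux_Q_add W hW (fun i => u i - c) (fun _ => c)
  simp only [sub_add_cancel] at h
  rw [h]
  have hcol : ∀ j, ∑ i, W i j = 1 := fun j => by
    rw [← hWrow j]; exact Finset.sum_congr rfl fun i _ => by rw [← hW.apply i j]; simp
  have h1 : ∀ i, ∑ j, W i j • c = c := fun i => by rw [← Finset.sum_smul, hWrow, one_smul]
  have h2 : ∑ i, ⟪(u i - c) - ∑ j, W i j • (u j - c), c⟫ = 0 := by
    rw [← sum_inner, Finset.sum_sub_distrib, Finset.sum_comm]
    simp_rw [← Finset.sum_smul, hcol, one_smul]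
    simp
  rw [h2]
  simp [h1]

lemma aux_mink (a b : Fin n → E) {A B : ℝ} (hA : 0 ≤ A) (hB : 0 ≤ B)
    (ha : ∑ i, ‖a i‖ ^ 2 ≤ A ^ 2) (hb : ∑ i, ‖b i‖ ^ 2 ≤ B ^ 2) :
    ∑ i, ‖a i - b i‖ ^ 2 ≤ (A + B) ^ 2 := by
  have hn : ∀ c : Fin n → E, ‖(WithLp.toLp 2 c : PiLp 2 fun _ : Fin n => E)‖ ^ 2 = ∑ i, ‖c i‖ ^ 2 :=
    fun c => by rw [PiLp.norm_sq_eq_of_L2]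
  have h1 := abs_le_of_sq_le_sq (ha.trans' (hn a).le) hA
  have h2 := abs_le_of_sq_le_sq (hb.trans' (hn b).le) hB
  rw [abs_le] at h1 h2
  have h3 := norm_sub_le (WithLp.toLp 2 a : PiLp 2 fun _ : Fin n => E) (WithLp.toLp 2 b)
  have h4 := hn (fun i => a i - b i)
  rw [← h4]
  refine pow_le_pow_left₀ (norm_nonneg _) ?_ 2
  exact h3.trans (add_le_add h1.2 h2.2)

lemma aux_center (hn : 0 < n) (g : Fin n → E) :
    ∑ i, ‖g i - (n:ℝ)⁻¹ • ∑ j, g j‖ ^ 2 ≤ ∑ i, ‖g i‖ ^ 2 := by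
  have hn' : (0:ℝ) < n := by exact_mod_cast hn
  set m := (n:ℝ)⁻¹ • ∑ j, g j with hm
  have hs : ∑ j, g j = (n:ℝ) • m := by rw [hm, smul_smul, mul_inv_cancel₀ hn'.ne', one_smul]
  simp_rw [norm_sub_sq_real, Finset.sum_add_distrib, Finset.sum_sub_distrib, ← Finset.mul_sum]
  rw [← sum_inner, hs, real_inner_smul_left, real_inner_self_eq_norm_sq]
  simp
  nlinarith [mul_nonneg hn'.le (sq_nonneg ‖m‖)]

lemma aux_single (e : Fin n → E) (he : ∑ i, e i = 0) (i : Fin n) :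
    (n:ℝ) * ‖e i‖ ^ 2 ≤ (n - 1) * ∑ j, ‖e j‖ ^ 2 := by
  have h1 := Finset.add_sum_erase Finset.univ e (Finset.mem_univ i)
  have h2 := Finset.add_sum_erase Finset.univ (fun j => ‖e j‖ ^ 2) (Finset.mem_univ i)
  rw [he] at h1
  have h3 : ‖e i‖ ≤ ∑ j ∈ Finset.univ.erase i, ‖e j‖ := by
    rw [eq_neg_of_add_eq_zero_left h1, norm_neg]; exact norm_sum_le _ _
  have h4 := sq_sum_le_card_mul_sum_sq (s := Finset.univ.erase i) (f := fun j => ‖e j‖)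
  have h5 : ((Finset.univ.erase i).card : ℝ) = n - 1 := by
    rw [Finset.card_erase_of_mem (Finset.mem_univ i), Finset.card_univ, Fintype.card_fin,
      Nat.cast_sub i.pos, Nat.cast_one]
  rw [h5] at h4
  have h6 := pow_le_pow_left₀ (norm_nonneg _) h3 2
  rw [← h2]
  nlinarith

end helpers2

theorem local_objective_error_bound
    {n p : ℕ} (hn : 0 < n)
    (f : Fin n → EuclideanSpace ℝ (Fin p) → ℝ)
    (gf : Fin n → EuclideanSpace ℝ (Fin p) → EuclideanSpace ℝ (Fin p))
    (Lf : Fin n → ℝ) (hLfpos : ∀ i, 0 < Lf i)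
    (hconv : ∀ i, ConvexOn ℝ Set.univ (f i))
    (hbdd : ∀ i, BddBelow (Set.range (f i)))
    (hgrad : ∀ i z, HasGradientAt (f i) (gf i z) z)
    (hlip : ∀ i, LipschitzWith (Lf i).toNNReal (gf i))
    (Lh : ℝ) (hLh : Lh = ⨆ i, Lf i)
    (W : Matrix (Fin n) (Fin n) ℝ)
    (hWsymm : W.IsHermitian)
    (hWnonneg : ∀ i j, 0 ≤ W i j)
    (hWrow : ∀ i, ∑ j, W i j = 1)
    (hWcol : ∀ j, ∑ i, W i j = 1)
    (lam : Fin n → ℝ) (hlamAnti : Antitone lam)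
    (hlamEig : ∃ σ : Equiv.Perm (Fin n), lam = hWsymm.eigenvalues ∘ σ)
    (hlam1 : lam ⟨0, hn⟩ = 1)
    (lamN : ℝ) (hlamN : lamN = lam ⟨n - 1, Nat.sub_lt hn Nat.one_pos⟩)
    (hlamNlb : -1 ≤ lamN)
    (β : ℝ) (hβdef : β = ⨆ j : {j : Fin n // j ≠ (⟨0, hn⟩ : Fin n)}, |lam j.1|)
    (α : ℝ) (hα : 0 < α)
    (x : ℕ → Fin n → EuclideanSpace ℝ (Fin p))
    (hiter : ∀ k i, x (k + 1) i = (∑ j, W i j • x k j) - α • gf i (x k i))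
    (hx0 : ∀ i, x 0 i = 0)
    (D : ℝ) (hD : D = Real.sqrt (2 * Lh * ((∑ i, f i 0) - ∑ i, ⨅ z, f i z)))
    (xbar : ℕ → EuclideanSpace ℝ (Fin p)) (hxbar : ∀ k, xbar k = (n : ℝ)⁻¹ • ∑ i, x k i)
    (fbar : EuclideanSpace ℝ (Fin p) → ℝ) (hfbar : ∀ z, fbar z = (n : ℝ)⁻¹ * ∑ i, f i z)
    (Lfbar : ℝ) (hLfbar : Lfbar = (n : ℝ)⁻¹ * ∑ i, Lf i)
    (xstar : EuclideanSpace ℝ (Fin p)) (hxstar : ∀ z, ∑ i, f i xstar ≤ ∑ i, f i z)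
    (rbar : ℕ → ℝ) (hrbar : ∀ k, rbar k = fbar (xbar k) - fbar xstar)
    (hstep : α ≤ min ((1 + lamN) / Lh) (1 / Lfbar))
    (hβlt : β < 1)
 :
    ∀ i, ∀ k, fbar (x k i) - fbar xstar ≤ rbar k + α * D ^ 2 / (1 - β) := by
  have hn' : (0:ℝ) < n := by exact_mod_cast hn
  have hn1 : (1:ℝ) ≤ n := by exact_mod_cast hn
  have hLle : ∀ i, Lf i ≤ Lh := fun i => by
    rw [hLh]; exact le_ciSup (Set.finite_range Lf).bddAbove i
  have hLpos : 0 < Lh := (hLfpos ⟨0, hn⟩).trans_le (hLle _)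
  have hL : ∀ i a b, ‖gf i a - gf i b‖ ≤ Lh * ‖a - b‖ := by
    intro i a b
    have h := (hlip i).dist_le_mul a b
    rw [dist_eq_norm, dist_eq_norm, Real.coe_toNNReal _ (hLfpos i).le] at h
    exact h.trans (mul_le_mul_of_nonneg_right (hLle i) (norm_nonneg _))
  have hαL : α * Lh ≤ 1 + lamN := (le_div_iff₀ hLpos).1 (hstep.trans (min_le_left _ _))
  have hβ0 : 0 ≤ β := by rw [hβdef]; exact Real.iSup_nonneg fun _ => abs_nonneg _
  have hG : 0 < 1 - β := by linarith
  obtain ⟨σ, hσ⟩ := hlamEig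
  have hev : ∀ k, hWsymm.eigenvalues k = lam (σ.symm k) := fun k => by simp [hσ]
  have hlow : ∀ k, lamN ≤ hWsymm.eigenvalues k := by
    intro k
    rw [hev, hlamN]
    exact hlamAnti (Fin.le_def.2 (by have := (σ.symm k).2; simp only; omega))
  have hk : ∀ k, k ≠ σ ⟨0, hn⟩ → |hWsymm.eigenvalues k| ≤ β := by
    intro k hk
    rw [hev, hβdef]
    have hne : σ.symm k ≠ ⟨0, hn⟩ := fun h => hk (by rw [← h]; simp)
    exact le_ciSup (f := fun j : {j : Fin n // j ≠ (⟨0, hn⟩ : Fin n)} => |lam j.1|)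
      (Set.finite_range _).bddAbove ⟨_, hne⟩
  -- notation
  set Q : ℕ → ℝ := fun k => (∑ i, ‖x k i‖ ^ 2) - ∑ i, ⟪x k i, ∑ j, W i j • x k j⟫ with hQ
  set h : ℕ → ℝ := fun k => ∑ i, f i (x k i) with hh
  have hdesc : ∀ k, Q (k+1) / 2 + α * h (k+1) ≤ Q k / 2 + α * h k := by
    intro k
    set d : Fin n → EuclideanSpace ℝ (Fin p) := fun i => x (k+1) i - x k i with hd
    have hxd : ∀ i, x (k+1) i = x k i + d i := fun i => by simp [hd]
    have e1 := aux_Q_add W hWsymm (x k) d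
    have e2 := aux_lower W hWsymm lamN hlow d
    have e3 : h (k+1) ≤ h k + ∑ i, ⟪gf i (x k i), d i⟫ + Lh / 2 * ∑ i, ‖d i‖ ^ 2 := by
      simp only [hh]
      rw [Finset.mul_sum, ← Finset.sum_add_distrib, ← Finset.sum_add_distrib]
      exact Finset.sum_le_sum fun i _ => aux_descent (hgrad i) (hL i) (x k i) (x (k+1) i)
    have e4 : ∑ i, ⟪x k i - ∑ j, W i j • x k j, d i⟫ + α * ∑ i, ⟪gf i (x k i), d i⟫
        = - ∑ i, ‖d i‖ ^ 2 := by
      rw [Finset.mul_sum, ← Finset.sum_add_distrib, ← Finset.sum_neg_distrib]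
      refine Finset.sum_congr rfl fun i _ => ?_
      rw [← real_inner_smul_left, ← inner_add_left, ← real_inner_self_eq_norm_sq, ← inner_neg_left]
      congr 1
      simp only [hd, hiter]
      abel
    have e5 : Q (k+1) = Q k + 2 * ∑ i, ⟪x k i - ∑ j, W i j • x k j, d i⟫
      + ((∑ i, ‖d i‖ ^ 2) - ∑ i, ⟪d i, ∑ j, W i j • d j⟫) := by
      simp only [hQ, hxd]; exact e1
    have hS : 0 ≤ ∑ i, ‖d i‖ ^ 2 := Finset.sum_nonneg fun i _ => sq_nonneg _
    have e6 := mul_le_mul_of_nonneg_left e3 hα.le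
    have e7 := mul_le_mul_of_nonneg_right hαL hS
    nlinarith
  have hlyap : ∀ k, Q k / 2 + α * h k ≤ α * ∑ i, f i 0 := by
    intro k
    induction k with
    | zero => simp [hQ, hh, hx0]
    | succ k ih => exact (hdesc k).trans ih
  have hD2 : D ^ 2 = 2 * Lh * ((∑ i, f i 0) - ∑ i, ⨅ z, f i z) := by
    rw [hD, Real.sq_sqrt]
    refine mul_nonneg (by positivity) (sub_nonneg.2 ?_)
    exact Finset.sum_le_sum fun i _ => ciInf_le (hbdd i) 0
  have hD0 : 0 ≤ D := by rw [hD]; exact Real.sqrt_nonneg _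
  have hgb : ∀ k, α * ∑ i, ‖gf i (x k i)‖ ^ 2 ≤ α * D ^ 2 - Lh * Q k := by
    intro k
    have e1 : ∑ i, ‖gf i (x k i)‖ ^ 2 ≤ 2 * Lh * (h k - ∑ i, ⨅ z, f i z) := by
      simp only [hh]
      rw [← Finset.sum_sub_distrib, Finset.mul_sum]
      exact Finset.sum_le_sum fun i _ => aux_grad_bound (hgrad i) hLpos (hL i) (hbdd i) _
    have e2 := mul_le_mul_of_nonneg_left e1 hα.le
    have e3 := mul_le_mul_of_nonneg_left (hlyap k) (by positivity : 0 ≤ 2 * Lh)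
    rw [hD2]
    nlinarith
  -- consensus error
  set e : ℕ → Fin n → EuclideanSpace ℝ (Fin p) := fun k i => x k i - xbar k with he
  have hsx : ∀ k, ∑ i, x k i = (n:ℝ) • xbar k := fun k => by
    rw [hxbar, smul_smul, mul_inv_cancel₀ hn'.ne', one_smul]
  have hesum : ∀ k, ∑ i, e k i = 0 := by
    intro k
    simp only [he]
    rw [Finset.sum_sub_distrib, hsx]
    simp [← Nat.cast_smul_eq_nsmul ℝ]
  have hQe : ∀ k, (1 - β) * ∑ i, ‖e k i‖ ^ 2 ≤ Q k := by
    intro k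
    have e1 := aux_Q_shift W hWsymm hWrow (x k) (xbar k)
    have e2 := (aux_upper hn W hWsymm hWrow _ β hβlt hk (e k) (hesum k)).1
    simp only [hQ]
    rw [← e1]
    linarith
  have hSnn : ∀ k, 0 ≤ ∑ i, ‖e k i‖ ^ 2 := fun k => Finset.sum_nonneg fun i _ => sq_nonneg _
  have hgD : ∀ k, ∑ i, ‖gf i (x k i)‖ ^ 2 ≤ D ^ 2 := by
    intro k
    have e1 : 0 ≤ Lh * Q k := mul_nonneg hLpos.le ((mul_nonneg hG.le (hSnn k)).trans (hQe k))
    exact le_of_mul_le_mul_left (by linarith [hgb k]) hα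
  have hLS : ∀ k, Lh * ∑ i, ‖e k i‖ ^ 2 ≤ α * D ^ 2 / (1 - β) := by
    intro k
    rw [le_div_iff₀ hG]
    have e1 := hgb k
    have e2 : 0 ≤ α * ∑ i, ‖gf i (x k i)‖ ^ 2 :=
      mul_nonneg hα.le (Finset.sum_nonneg fun i _ => sq_nonneg _)
    have e3 := mul_le_mul_of_nonneg_left (hQe k) hLpos.le
    linarith
  have hR0 : 0 ≤ α * D / (1 - β) := by positivity
  have hcons : ∀ k, ∑ i, ‖e k i‖ ^ 2 ≤ (α * D / (1 - β)) ^ 2 := by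
    intro k
    induction k with
    | zero =>
      have : ∀ i, e 0 i = 0 := fun i => by simp [he, hxbar, hx0]
      simp only [this]
      simp
      positivity
    | succ k ih =>
      have hxb : xbar (k+1) = xbar k - α • ((n:ℝ)⁻¹ • ∑ j, gf j (x k j)) := by
        rw [hxbar (k+1)]
        simp_rw [hiter]
        rw [Finset.sum_sub_distrib, Finset.sum_comm]
        simp_rw [← Finset.sum_smul, hWcol, one_smul]
        rw [smul_sub, ← hxbar, ← Finset.smul_sum, smul_comm]
      have e1 : ∀ i, e (k+1) i = (∑ j, W i j • e k j)
          - α • (gf i (x k i) - (n:ℝ)⁻¹ • ∑ j, gf j (x k j)) := by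
        intro i
        simp only [he]
        rw [hxb, hiter]
        simp_rw [smul_sub, Finset.sum_sub_distrib, ← Finset.sum_smul, hWrow, one_smul]
        abel
      have e2 := (aux_upper hn W hWsymm hWrow _ β hβlt hk (e k) (hesum k)).2
      have e3 : ∑ i, ‖∑ j, W i j • e k j‖ ^ 2 ≤ (β * (α * D / (1 - β))) ^ 2 := by
        rw [mul_pow]
        exact e2.trans (mul_le_mul_of_nonneg_left ih (sq_nonneg _))
      have e4 : ∑ i, ‖α • (gf i (x k i) - (n:ℝ)⁻¹ • ∑ j, gf j (x k j))‖ ^ 2 ≤ (α * D) ^ 2 := by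
        simp_rw [norm_smul, mul_pow, Real.norm_eq_abs, sq_abs]
        rw [← Finset.mul_sum]
        exact mul_le_mul_of_nonneg_left
          ((aux_center hn (fun i => gf i (x k i))).trans (hgD k)) (sq_nonneg _)
      have e5 := aux_mink _ _ (mul_nonneg hβ0 hR0) (mul_nonneg hα.le hD0) e3 e4
      simp_rw [e1]
      refine e5.trans (le_of_eq ?_)
      congr 1
      field_simp
      ring
  intro i k
  rw [hrbar]
  suffices hs : ∑ j, f j (x k i) - ∑ j, f j (xbar k) ≤ n * (α * D ^ 2 / (1 - β)) by
    have : (n:ℝ)⁻¹ * (∑ j, f j (x k i) - ∑ j, f j (xbar k)) ≤ α * D ^ 2 / (1 - β) := by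
      rw [inv_mul_le_iff₀ hn']; exact hs
    rw [hfbar (x k i), hfbar (xbar k)]
    linarith
  have hS := hSnn k
  have hsing := aux_single (e k) (hesum k) i
  set S := ∑ j, ‖e k j‖ ^ 2 with hSdef
  have t1 : ∑ j, f j (x k i) - ∑ j, f j (xbar k)
      ≤ ∑ j, ⟪gf j (x k j), e k i⟫ + Lh / 2 * ∑ j, ‖x k i - x k j‖ ^ 2 := by
    rw [← Finset.sum_sub_distrib, Finset.mul_sum, ← Finset.sum_add_distrib]
    refine Finset.sum_le_sum fun j _ => ?_
    have a1 := aux_descent (hgrad j) (hL j) (x k j) (x k i)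
    have a2 := aux_convex (hgrad j) (hconv j) (x k j) (xbar k)
    have a3 : ⟪gf j (x k j), e k i⟫
        = ⟪gf j (x k j), x k i - x k j⟫ - ⟪gf j (x k j), xbar k - x k j⟫ := by
      rw [← inner_sub_right]; congr 1; simp only [he]; abel
    linarith
  have t2 : ∑ j, ‖x k i - x k j‖ ^ 2 = n * ‖e k i‖ ^ 2 + S := by
    have : ∀ j, x k i - x k j = e k i - e k j := fun j => by simp [he]
    simp_rw [this, norm_sub_sq_real, Finset.sum_add_distrib, Finset.sum_sub_distrib,
      ← Finset.mul_sum, ← inner_sum, hesum]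
    simp [hSdef]
  have t3 : ∑ j, ⟪gf j (x k j), e k i⟫ ≤ n / 2 * (D * (α * D / (1 - β))) := by
    have b1 : ∑ j, ⟪gf j (x k j), e k i⟫ ≤ (∑ j, ‖gf j (x k j)‖) * ‖e k i‖ := by
      rw [Finset.sum_mul]; exact Finset.sum_le_sum fun j _ => real_inner_le_norm _ _
    refine b1.trans (abs_le_of_sq_le_sq' ?_ (by positivity)).2
    have b2 := sq_sum_le_card_mul_sum_sq (s := Finset.univ) (f := fun j => ‖gf j (x k j)‖)
    simp only [Finset.card_univ, Fintype.card_fin] at b2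
    have b3 : (∑ j, ‖gf j (x k j)‖) ^ 2 ≤ n * D ^ 2 :=
      b2.trans (mul_le_mul_of_nonneg_left (hgD k) hn'.le)
    calc ((∑ j, ‖gf j (x k j)‖) * ‖e k i‖) ^ 2
        = (∑ j, ‖gf j (x k j)‖) ^ 2 * ‖e k i‖ ^ 2 := by ring
      _ ≤ n * D ^ 2 * ‖e k i‖ ^ 2 := mul_le_mul_of_nonneg_right b3 (sq_nonneg _)
      _ = D ^ 2 * (n * ‖e k i‖ ^ 2) := by ring
      _ ≤ D ^ 2 * ((n - 1) * S) := mul_le_mul_of_nonneg_left hsing (sq_nonneg _)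
      _ ≤ D ^ 2 * ((n / 2) ^ 2 * S) := by
          refine mul_le_mul_of_nonneg_left (mul_le_mul_of_nonneg_right ?_ hS) (sq_nonneg _)
          nlinarith [sq_nonneg ((n:ℝ) - 2)]
      _ ≤ D ^ 2 * ((n / 2) ^ 2 * (α * D / (1 - β)) ^ 2) := by
          have := hcons k
          gcongr
      _ = _ := by ring
  have t4 : Lh / 2 * (n * ‖e k i‖ ^ 2 + S) ≤ n / 2 * (α * D ^ 2 / (1 - β)) := by
    calc Lh / 2 * (n * ‖e k i‖ ^ 2 + S) ≤ Lh / 2 * ((n - 1) * S + S) := by gcongr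
      _ = n / 2 * (Lh * S) := by ring
      _ ≤ _ := mul_le_mul_of_nonneg_left (hLS k) (by positivity)
  rw [t2] at t1
  have t5 : D * (α * D / (1 - β)) = α * D ^ 2 / (1 - β) := by ring
  rw [t5] at t3
  linarith
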